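/- Let d ∈ {1,2,3}, let Ω ⊆ ℝ^d be a nonempty bounded open set, let b, c > 0, k, σ ∈ ℝ and T > 0. There exists δ > 0 (depending on d, Ω, b, c, k, σ, T) such that: if ψ and φ are admissible, both solve the Blackstock equation w_tt − c²(1 − 2k w_t)Δw − b Δw_t + 2σ ∇w·∇w_t = 0 on [0,T] × Ω, have the same initial data ψ(0,·) = φ(0,·) and ψ_t(0,·) = φ_t(0,·), and satisfy N_T(ψ) ≤ δ and N_T(φ) ≤ δ, then ψ(t,x) = φ(t,x) for all (t,x) ∈ [0,T] × Ω. -/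

import Mathlib

open MeasureTheory Real

noncomputable section

/-- Euclidean space ℝ^d. -/
abbrev Spc (d : ℕ) := EuclideanSpace ℝ (Fin d)

variable {d : ℕ}

/-- Spatial Laplacian: sum of second derivatives in the coordinate directions. -/
def lap (g : Spc d → ℝ) (x : Spc d) : ℝ :=
  ∑ i, fderiv ℝ (fun y => fderiv ℝ g y (EuclideanSpace.single i 1)) x (EuclideanSpace.single i 1)

/-- Squared L²(Ω) norm: ‖g‖² = ∫_Ω g². -/
def sqL2 (Ω : Set (Spc d)) (g : Spc d → ℝ) : ℝ := ∫ x in Ω, (g x) ^ 2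

/-- Squared L²(Ω) norm of the gradient: ‖∇g‖² = ∫_Ω |∇g|². -/
def sqGrad (Ω : Set (Spc d)) (g : Spc d → ℝ) : ℝ := ∫ x in Ω, ‖gradient g x‖ ^ 2

/-- Squared L²(Ω) norm of the Hessian: ‖D²g‖² = ∫_Ω |D²g|². -/
def sqHess (Ω : Set (Spc d)) (g : Spc d → ℝ) : ℝ := ∫ x in Ω, ‖iteratedFDeriv ℝ 2 g x‖ ^ 2

/-- Squared H¹(Ω) norm. -/
def sqH1 (Ω : Set (Spc d)) (g : Spc d → ℝ) : ℝ := sqL2 Ω g + sqGrad Ω g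

/-- Squared H²(Ω) norm. -/
def sqH2 (Ω : Set (Spc d)) (g : Spc d → ℝ) : ℝ := sqL2 Ω g + sqGrad Ω g + sqHess Ω g

/-- H⁻¹(Ω) norm by duality against smooth compactly supported test functions. -/
def negH1 (Ω : Set (Spc d)) (g : Spc d → ℝ) : ℝ :=
  sSup { r : ℝ | ∃ φ : Spc d → ℝ, ContDiff ℝ (⊤ : ℕ∞) φ ∧ HasCompactSupport φ ∧ tsupport φ ⊆ Ω ∧
      (∫ x in Ω, ‖gradient φ x‖ ^ 2) ≤ 1 ∧ r = ∫ x in Ω, g x * φ x }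

/-- Admissible: smooth in (t,x), with spatial support in a fixed compact subset of Ω. -/
def Admissible (Ω : Set (Spc d)) (w : ℝ → Spc d → ℝ) : Prop :=
  ContDiff ℝ (⊤ : ℕ∞) (fun p : ℝ × Spc d => w p.1 p.2) ∧
  ∃ K : Set (Spc d), IsCompact K ∧ K ⊆ Ω ∧ ∀ t, Function.support (w t) ⊆ K

/-- Inner product of two spatial gradients: ∇g·∇h. -/
def gdot (g h : Spc d → ℝ) (x : Spc d) : ℝ := @inner ℝ _ _ (gradient g x) (gradient h x)

/-- Time derivative. -/
def tderiv (w : ℝ → Spc d → ℝ) (t : ℝ) (x : Spc d) : ℝ := deriv (fun s => w s x) t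

/-- The Blackstock equation ψ_tt − c²(1 − 2k ψ_t)Δψ − b Δψ_t + 2σ ∇ψ·∇ψ_t = 0
holds at time `t` on `Ω`. -/
def IsBlackstock (Ω : Set (Spc d)) (b c k σ : ℝ) (ψ : ℝ → Spc d → ℝ) (t : ℝ) : Prop :=
  ∀ x ∈ Ω,
    (tderiv (tderiv ψ) t x - c ^ 2 * (1 - 2 * k * tderiv ψ t x) * lap (ψ t) x
      - b * lap (tderiv ψ t) x
      + 2 * σ * gdot (ψ t) (tderiv ψ t) x) = 0

/-- Energy E(t). -/
def energy (Ω : Set (Spc d)) (b c : ℝ) (ψ : ℝ → Spc d → ℝ) (t : ℝ) : ℝ :=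
  (1 / 2) * sqL2 Ω (tderiv ψ t) + (c ^ 2 / 2) * sqGrad Ω (ψ t)
    + (c ^ 2 / (2 * b)) * sqL2 Ω (lap (ψ t)) + sqGrad Ω (tderiv ψ t)

/-- Dissipation D(t). -/
def dissip (Ω : Set (Spc d)) (ψ : ℝ → Spc d → ℝ) (t : ℝ) : ℝ :=
  ∫ s in (0:ℝ)..t,
    (sqGrad Ω (tderiv ψ s) + sqL2 Ω (lap (tderiv ψ s)) + sqGrad Ω (ψ s)
      + sqL2 Ω (lap (ψ s)) + sqL2 Ω (tderiv (tderiv ψ) s))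

/-- Supremum of a function of time over [0,T]. -/
def supIcc (T : ℝ) (f : ℝ → ℝ) : ℝ := ⨆ t : Set.Icc (0:ℝ) T, f t

/-- f := −2k c² ψ_t Δψ − 2σ ∇ψ·∇ψ_t, the right-hand side nonlinearity. -/
def blackF (c k σ : ℝ) (ψ : ℝ → Spc d → ℝ) (t : ℝ) (x : Spc d) : ℝ :=
  -(2 * k * c ^ 2) * tderiv ψ t x * lap (ψ t) x - 2 * σ * gdot (ψ t) (tderiv ψ t) x

/-- The nonlocal heat equation v_t − b Δv − c² Δψ = f (with v = ψ_t) holds at time `t` on `Ω`. -/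
def IsHeat (Ω : Set (Spc d)) (b c : ℝ) (ψ f : ℝ → Spc d → ℝ) (t : ℝ) : Prop :=
  ∀ x ∈ Ω,
    tderiv (tderiv ψ) t x - b * lap (tderiv ψ t) x - c ^ 2 * lap (ψ t) x = f t x

/-- The linearized Blackstock equation
ψ_tt − c²(1 − 2k α)Δψ − b Δψ_t + 2σ ∇ψ·∇α = f̃ holds at time `t` on `Ω`. -/
def IsLinBlackstock (Ω : Set (Spc d)) (b c k σ : ℝ) (α ψ f : ℝ → Spc d → ℝ) (t : ℝ) : Prop :=
  ∀ x ∈ Ω,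
    tderiv (tderiv ψ) t x - c ^ 2 * (1 - 2 * k * α t x) * lap (ψ t) x
      - b * lap (tderiv ψ t) x + 2 * σ * gdot (ψ t) (α t) x = f t x

/-- Time-weighted norm N_T^v for the velocity variable. -/
def normV (Ω : Set (Spc d)) (T : ℝ) (α : ℝ → Spc d → ℝ) : ℝ :=
  supIcc T (fun t => Real.sqrt (sqH1 Ω (α t)))
    + Real.sqrt (∫ t in (0:ℝ)..T, (sqL2 Ω (α t) + sqGrad Ω (α t) + sqL2 Ω (lap (α t))))
    + Real.sqrt (∫ t in (0:ℝ)..T, sqL2 Ω (tderiv α t))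
    + supIcc T (fun t => Real.sqrt t * Real.sqrt (sqL2 Ω (tderiv α t)))
    + Real.sqrt (∫ t in (0:ℝ)..T, t * sqGrad Ω (tderiv α t))
    + supIcc T (fun t => Real.sqrt t * Real.sqrt (sqL2 Ω (lap (α t))))

/-- Time-weighted solution norm N_T(ψ) = sup_{[0,T]} ‖ψ(t)‖_{H²} + N_T^v(ψ_t). -/
def normX (Ω : Set (Spc d)) (T : ℝ) (ψ : ℝ → Spc d → ℝ) : ℝ :=
  supIcc T (fun t => Real.sqrt (sqH2 Ω (ψ t))) + normV Ω T (tderiv ψ)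

open scoped ContDiff Topology

/-- Directional derivative on spacetime. -/
def dirD {d : ℕ} (v : ℝ × Spc d) (f : ℝ × Spc d → ℝ) (p : ℝ × Spc d) : ℝ := fderiv ℝ f p v

/-- Smooth with spatial support in `K`. -/
def Nice {d : ℕ} (K : Set (Spc d)) (f : ℝ × Spc d → ℝ) : Prop :=
  ContDiff ℝ ∞ f ∧ ∀ p : ℝ × Spc d, p.2 ∉ K → f p = 0

lemma smooth_dirD {d : ℕ} {f : ℝ × Spc d → ℝ} (v : ℝ × Spc d) (hf : ContDiff ℝ ∞ f) :
    ContDiff ℝ ∞ (dirD v f) := by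
  unfold dirD
  exact (hf.fderiv_right (m := ∞) (by simp)).clm_apply contDiff_const

lemma smooth_diff {d : ℕ} {f : ℝ × Spc d → ℝ} (hf : ContDiff ℝ ∞ f) (p : ℝ × Spc d) :
    DifferentiableAt ℝ f p := hf.differentiable (by simp) p

lemma nice_dirD {d : ℕ} {K : Set (Spc d)} (hK : IsCompact K) {f : ℝ × Spc d → ℝ}
    (v : ℝ × Spc d) (hf : Nice K f) : Nice K (dirD v f) := by
  refine ⟨smooth_dirD v hf.1, fun p hp => ?_⟩
  have ho : {q : ℝ × Spc d | q.2 ∉ K} ∈ 𝓝 p :=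
    (hK.isClosed.isOpen_compl.preimage continuous_snd).mem_nhds hp
  have : f =ᶠ[𝓝 p] fun _ => 0 := by
    filter_upwards [ho] with q hq using hf.2 q hq
  unfold dirD
  rw [this.fderiv_eq]
  simp

lemma dirD_comm {d : ℕ} {f : ℝ × Spc d → ℝ} (hf : ContDiff ℝ ∞ f) (v w : ℝ × Spc d) :
    dirD v (dirD w f) = dirD w (dirD v f) := by
  funext p
  have hd : DifferentiableAt ℝ (fderiv ℝ f) p :=
    (hf.fderiv_right (m := ∞) (by simp)).differentiable (by simp) p
  have key : ∀ v w : ℝ × Spc d, dirD v (dirD w f) p = fderiv ℝ (fderiv ℝ f) p v w := by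
    intro v w
    have := (hd.hasFDerivAt.clm_apply (hasFDerivAt_const w p)).fderiv
    unfold dirD
    rw [this]; simp
  rw [key, key]
  exact (hf.contDiffAt.isSymmSndFDerivAt (by
    rw [minSmoothness_of_isRCLikeNormedField]; exact WithTop.coe_le_coe.2 (le_top : (2 : ℕ∞) ≤ ⊤))) v w

lemma dirD_mul {d : ℕ} {f g : ℝ × Spc d → ℝ} (v : ℝ × Spc d) (p : ℝ × Spc d)
    (hf : ContDiff ℝ ∞ f) (hg : ContDiff ℝ ∞ g) :
    dirD v (fun q => f q * g q) p = dirD v f p * g p + f p * dirD v g p := by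
  unfold dirD
  rw [fderiv_fun_mul (smooth_diff hf p) (smooth_diff hg p)]
  simp; ring

lemma dirD_add {d : ℕ} {f g : ℝ × Spc d → ℝ} (v : ℝ × Spc d) (p : ℝ × Spc d)
    (hf : ContDiff ℝ ∞ f) (hg : ContDiff ℝ ∞ g) :
    dirD v (fun q => f q + g q) p = dirD v f p + dirD v g p := by
  unfold dirD
  rw [fderiv_fun_add (smooth_diff hf p) (smooth_diff hg p)]
  simp

lemma dirD_sub {d : ℕ} {f g : ℝ × Spc d → ℝ} (v : ℝ × Spc d)
    (hf : ContDiff ℝ ∞ f) (hg : ContDiff ℝ ∞ g) :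
    dirD v (fun q => f q - g q) = fun p => dirD v f p - dirD v g p := by
  funext p
  unfold dirD
  rw [fderiv_fun_sub (smooth_diff hf p) (smooth_diff hg p)]
  simp

lemma dirD_const_mul {d : ℕ} {f : ℝ × Spc d → ℝ} (v : ℝ × Spc d) (p : ℝ × Spc d) (r : ℝ)
    (hf : ContDiff ℝ ∞ f) :
    dirD v (fun q => r * f q) p = r * dirD v f p := by
  unfold dirD
  rw [fderiv_const_mul (smooth_diff hf p)]
  simp

lemma dirD_sum {d : ℕ} {f : Fin d → ℝ × Spc d → ℝ} (v : ℝ × Spc d) (p : ℝ × Spc d)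
    (hf : ∀ i, ContDiff ℝ ∞ (f i)) :
    dirD v (fun q => ∑ i, f i q) p = ∑ i, dirD v (f i) p := by
  unfold dirD
  rw [fderiv_fun_sum (fun i _ => smooth_diff (hf i) p)]
  simp

lemma slice_x {d : ℕ} {f : ℝ × Spc d → ℝ} (hf : ContDiff ℝ ∞ f) (t : ℝ) (x v : Spc d) :
    fderiv ℝ (fun y => f (t, y)) x v = dirD (0, v) f (t, x) := by
  have h := (smooth_diff hf (t, x)).hasFDerivAt.comp x (hasFDerivAt_prodMk_right t x)
  have h2 := h.fderiv
  unfold dirD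
  change fderiv ℝ (f ∘ fun y => (t, y)) x v = _
  rw [h2]; simp

lemma slice_t {d : ℕ} {f : ℝ × Spc d → ℝ} (hf : ContDiff ℝ ∞ f) (t : ℝ) (x : Spc d) :
    HasDerivAt (fun s => f (s, x)) (dirD (1, 0) f (t, x)) t := by
  have h := (smooth_diff hf (t, x)).hasFDerivAt.comp t (hasFDerivAt_prodMk_left (𝕜 := ℝ) t x)
  have h2 := h.hasDerivAt
  unfold dirD
  exact h2

lemma nice_int {d : ℕ} {K : Set (Spc d)} (hK : IsCompact K) {f : ℝ × Spc d → ℝ}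
    (hf : Nice K f) (t : ℝ) : Integrable (fun x => f (t, x)) := by
  apply Continuous.integrable_of_hasCompactSupport
  · exact hf.1.continuous.comp (by fun_prop)
  · exact HasCompactSupport.intro hK (fun x hx => hf.2 (t, x) hx)

lemma int_dirD_zero {d : ℕ} {K : Set (Spc d)} (hK : IsCompact K) {f : ℝ × Spc d → ℝ}
    (hf : Nice K f) (t : ℝ) (v : Spc d) : ∫ x, dirD (0, v) f (t, x) = 0 := by
  have h := integral_mul_fderiv_eq_neg_fderiv_mul_of_integrable (μ := (volume : Measure (Spc d)))
    (f := fun _ => (1:ℝ)) (g := fun x => f (t, x)) (v := v) (by simp)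
    (by simpa [slice_x hf.1] using nice_int hK (nice_dirD hK (0, v) hf) t)
    (by simpa using nice_int hK hf t) (fun x _ => by fun_prop)
    (fun x _ => (hf.1.comp (contDiff_prodMk_right t)).differentiable (by simp) x)
  simpa [slice_x hf.1] using h

lemma int_hasDeriv {d : ℕ} {K : Set (Spc d)} (hK : IsCompact K) {f : ℝ × Spc d → ℝ}
    (hf : Nice K f) (t : ℝ) :
    HasDerivAt (fun s => ∫ x, f (s, x)) (∫ x, dirD (1, 0) f (t, x)) t := by
  have hD := nice_dirD hK (1, 0) hf
  obtain ⟨M, hM⟩ := ((isCompact_Icc (a := t - 1) (b := t + 1)).prod hK).exists_bound_of_continuousOn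
    hD.1.continuous.continuousOn
  refine (hasDerivAt_integral_of_dominated_loc_of_deriv_le (s := Set.Icc (t-1) (t+1))
    (bound := K.indicator fun _ => M)
    (F := fun s x => f (s, x)) (F' := fun s x => dirD (1, 0) f (s, x))
    (Icc_mem_nhds (by linarith) (by linarith))
    (Filter.Eventually.of_forall fun s => (nice_int hK hf s).aestronglyMeasurable)
    (nice_int hK hf t) (nice_int hK hD t).aestronglyMeasurable
    (Filter.Eventually.of_forall fun x s hs => ?_) ?_
    (Filter.Eventually.of_forall fun x s _ => slice_t hf.1 s x)).2
  · by_cases hx : x ∈ K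
    · simpa [hx] using hM (s, x) ⟨hs, hx⟩
    · simp only [hx, not_false_eq_true, Set.indicator_of_notMem]
      rw [hD.2 (s, x) hx]; simp
  · rw [integrable_indicator_iff hK.measurableSet]
    exact integrableOn_const hK.measure_lt_top.ne

lemma gdot_eq {d : ℕ} (g h : Spc d → ℝ) (x : Spc d) :
    gdot g h x = ∑ i, fderiv ℝ g x (EuclideanSpace.single i 1)
      * fderiv ℝ h x (EuclideanSpace.single i 1) := by
  have key : ∀ (g : Spc d → ℝ) i, (gradient g x) i = fderiv ℝ g x (EuclideanSpace.single i 1) := by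
    intro g i
    have h1 : fderiv ℝ g x (EuclideanSpace.single i 1)
        = @inner ℝ _ _ (gradient g x) (EuclideanSpace.single i 1) := by
      rw [← toDual_gradient]; rfl
    rw [h1, EuclideanSpace.inner_single_right]
    simp
  unfold gdot
  rw [PiLp.inner_apply]
  simp only [key]
  refine Finset.sum_congr rfl fun i _ => ?_
  simp [mul_comm]

/-- the i-th spatial direction in spacetime -/
def ee {d : ℕ} (i : Fin d) : ℝ × Spc d := (0, EuclideanSpace.single i 1)

/-- the time direction in spacetime -/
def tt {d : ℕ} : ℝ × Spc d := (1, 0)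

lemma lap_eq {d : ℕ} {f : ℝ × Spc d → ℝ} (hf : ContDiff ℝ ∞ f) (t : ℝ) (x : Spc d) :
    lap (fun y => f (t, y)) x = ∑ i, dirD (ee i) (dirD (ee i) f) (t, x) := by
  unfold lap
  refine Finset.sum_congr rfl fun i _ => ?_
  simp only [slice_x hf]
  rw [slice_x (smooth_dirD _ hf)]
  rfl

lemma tderiv_eq {d : ℕ} {f : ℝ × Spc d → ℝ} (hf : ContDiff ℝ ∞ f) :
    tderiv (fun t x => f (t, x)) = fun t x => dirD tt f (t, x) := by
  funext t x
  exact (slice_t hf t x).deriv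

/-- The Blackstock equation in spacetime form. -/
lemma blackstock_eq {d : ℕ} {Ω : Set (Spc d)} {b c k σ : ℝ} {ψ : ℝ → Spc d → ℝ} {t : ℝ}
    {K : Set (Spc d)} (hK : IsCompact K) (hKΩ : K ⊆ Ω)
    (hf : Nice K (fun p : ℝ × Spc d => ψ p.1 p.2)) (h : IsBlackstock Ω b c k σ ψ t) (x : Spc d) :
    let f := fun p : ℝ × Spc d => ψ p.1 p.2
    dirD tt (dirD tt f) (t, x)
      - c ^ 2 * (1 - 2 * k * dirD tt f (t, x)) * ∑ i, dirD (ee i) (dirD (ee i) f) (t, x)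
      - b * ∑ i, dirD (ee i) (dirD (ee i) (dirD tt f)) (t, x)
      + 2 * σ * ∑ i, dirD (ee i) f (t, x) * dirD (ee i) (dirD tt f) (t, x) = 0 := by
  intro f
  by_cases hx : x ∈ Ω
  · have h1 := h x hx
    have e0 : ψ = fun t x => f (t, x) := rfl
    have e1 : tderiv ψ = fun t x => dirD tt f (t, x) := tderiv_eq hf.1
    have e2 : tderiv (tderiv ψ) = fun t x => dirD tt (dirD tt f) (t, x) := by
      rw [e1, tderiv_eq (smooth_dirD _ hf.1)]
    rw [e2, e1, gdot_eq, lap_eq (smooth_dirD _ hf.1)] at h1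
    rw [show ψ t = fun x => f (t, x) from rfl, lap_eq hf.1] at h1
    have hf' : ContDiff ℝ ∞ f := hf.1
    simp only [slice_x hf', slice_x (smooth_dirD tt hf')] at h1
    exact h1
  · have hx' : x ∉ K := fun h => hx (hKΩ h)
    have hN : ∀ v {g}, Nice K g → Nice K (dirD v g) := fun v g hg => nice_dirD hK v hg
    have z : ∀ {g : ℝ × Spc d → ℝ}, Nice K g → g (t, x) = 0 := fun hg => hg.2 (t, x) hx'
    have z1 := z (hN tt hf)
    have z2 := z (hN tt (hN tt hf))
    have z3 := fun i => z (hN (ee i) (hN (ee i) hf))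
    have z4 := fun i => z (hN (ee i) (hN (ee i) (hN tt hf)))
    have z5 := fun i => z (hN (ee i) hf)
    simp [f, z1, z2, z3, z4, z5]

lemma quad_bound {b A B D a p q : ℝ} (hb : 0 < b) :
    -b * q ^ 2 + q * (A * p + B * a) + D * a * p
      ≤ ((A ^ 2 + B ^ 2) / (2 * b) + |D|) * (a ^ 2 + p ^ 2) := by
  have h1 : D * a * p ≤ |D| * (a ^ 2 + p ^ 2) := by
    have : D * (a * p) ≤ |D| * |a * p| := by
      rw [← abs_mul]; exact le_abs_self _
    have h2 : |a * p| ≤ a ^ 2 + p ^ 2 := by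
      rw [abs_le]; constructor <;> nlinarith [sq_nonneg (a - p), sq_nonneg (a + p)]
    nlinarith [mul_le_mul_of_nonneg_left h2 (abs_nonneg D)]
  have h3 : -b * q ^ 2 + q * (A * p + B * a) ≤ (A * p + B * a) ^ 2 / (4 * b) := by
    rw [le_div_iff₀ (by positivity)]
    nlinarith [sq_nonneg (2 * b * q - (A * p + B * a))]
  have h4 : (A * p + B * a) ^ 2 / (4 * b) ≤ (A ^ 2 + B ^ 2) / (2 * b) * (a ^ 2 + p ^ 2) := by
    rw [div_mul_eq_mul_div, div_le_div_iff₀ (by positivity) (by positivity)]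
    have : (A * p + B * a) ^ 2 ≤ (A ^ 2 + B ^ 2) * (a ^ 2 + p ^ 2) := by
      nlinarith [sq_nonneg (A * a - B * p)]
    have h5 : 0 ≤ (A ^ 2 + B ^ 2) * (a ^ 2 + p ^ 2) := by positivity
    nlinarith
  nlinarith

lemma gronwall_zero {E E' : ℝ → ℝ} {C T : ℝ} (h0 : E 0 = 0) (hn : ∀ t, 0 ≤ E t)
    (hd : ∀ t, HasDerivAt E (E' t) t) (hE : ∀ t ∈ Set.Icc (0:ℝ) T, E' t ≤ C * E t) :
    ∀ t ∈ Set.Icc (0:ℝ) T, E t = 0 := by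
  intro t ht
  have hD : ∀ s, HasDerivAt (fun s => Real.exp (-(C * s)) * E s)
      (Real.exp (-(C * s)) * (-(C * 1)) * E s + Real.exp (-(C * s)) * E' s) s := fun s =>
    ((((hasDerivAt_id s).const_mul C).neg).exp).mul (hd s)
  have ha : AntitoneOn (fun s => Real.exp (-(C * s)) * E s) (Set.Icc 0 T) := by
    apply antitoneOn_of_deriv_nonpos (convex_Icc 0 T)
    · exact fun s _ => (hD s).continuousAt.continuousWithinAt
    · exact fun s _ => (hD s).differentiableAt.differentiableWithinAt
    · intro s hs
      rw [(hD s).deriv]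
      have := hE s (interior_subset hs)
      have he := Real.exp_pos (-(C * s))
      nlinarith
  have h1 := ha ⟨le_rfl, ht.1.trans ht.2⟩ ht ht.1
  simp only [h0, mul_zero] at h1
  have he := Real.exp_pos (-(C * t))
  have h2 := hn t
  nlinarith

/-- Energy argument: the difference of two solutions has vanishing time derivative. -/
lemma diff_tderiv_zero {d : ℕ} {K : Set (Spc d)} (hK : IsCompact K) {b c k σ T : ℝ}
    (hb : 0 < b) (hc : 0 < c) {f g : ℝ × Spc d → ℝ} (hf : Nice K f) (hg : Nice K g)
    (ef : ∀ t ∈ Set.Icc (0:ℝ) T, ∀ x, dirD tt (dirD tt f) (t, x)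
      - c ^ 2 * (1 - 2 * k * dirD tt f (t, x)) * ∑ i, dirD (ee i) (dirD (ee i) f) (t, x)
      - b * ∑ i, dirD (ee i) (dirD (ee i) (dirD tt f)) (t, x)
      + 2 * σ * ∑ i, dirD (ee i) f (t, x) * dirD (ee i) (dirD tt f) (t, x) = 0)
    (eg : ∀ t ∈ Set.Icc (0:ℝ) T, ∀ x, dirD tt (dirD tt g) (t, x)
      - c ^ 2 * (1 - 2 * k * dirD tt g (t, x)) * ∑ i, dirD (ee i) (dirD (ee i) g) (t, x)
      - b * ∑ i, dirD (ee i) (dirD (ee i) (dirD tt g)) (t, x)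
      + 2 * σ * ∑ i, dirD (ee i) g (t, x) * dirD (ee i) (dirD tt g) (t, x) = 0)
    (h0 : ∀ x, f (0, x) = g (0, x)) (h1 : ∀ x, dirD tt f (0, x) = dirD tt g (0, x)) :
    ∀ t ∈ Set.Icc (0:ℝ) T, ∀ x, dirD tt (fun p => f p - g p) (t, x) = 0 := by
  obtain ⟨U, hU⟩ : ∃ U : ℝ × Spc d → ℝ, U = fun p => f p - g p := ⟨_, rfl⟩
  have nU : Nice K U := by
    subst hU
    exact ⟨hf.1.sub hg.1, fun p hp => by simp [hf.2 p hp, hg.2 p hp]⟩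
  rw [← hU]
  have sf := hf.1
  have sg := hg.1
  have sU := nU.1
  have S : ∀ v {h : ℝ × Spc d → ℝ}, ContDiff ℝ ∞ h → ContDiff ℝ ∞ (dirD v h) :=
    fun v _ hh => smooth_dirD v hh
  have N : ∀ v {h : ℝ × Spc d → ℝ}, Nice K h → Nice K (dirD v h) :=
    fun v _ hh => nice_dirD hK v hh
  have Ut : dirD tt U = fun p => dirD tt f p - dirD tt g p := by rw [hU, dirD_sub _ sf sg]
  have Utt : dirD tt (dirD tt U) = fun p => dirD tt (dirD tt f) p - dirD tt (dirD tt g) p := by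
    rw [Ut, dirD_sub _ (S _ sf) (S _ sg)]
  have Ui : ∀ i, dirD (ee i) U = fun p => dirD (ee i) f p - dirD (ee i) g p := fun i => by
    rw [hU, dirD_sub _ sf sg]
  have Uii : ∀ i, dirD (ee i) (dirD (ee i) U)
      = fun p => dirD (ee i) (dirD (ee i) f) p - dirD (ee i) (dirD (ee i) g) p := fun i => by
    rw [Ui, dirD_sub _ (S _ sf) (S _ sg)]
  have Uti : ∀ i, dirD (ee i) (dirD tt U)
      = fun p => dirD (ee i) (dirD tt f) p - dirD (ee i) (dirD tt g) p := fun i => by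
    rw [Ut, dirD_sub _ (S _ sf) (S _ sg)]
  have Utii : ∀ i, dirD (ee i) (dirD (ee i) (dirD tt U))
      = fun p => dirD (ee i) (dirD (ee i) (dirD tt f)) p
        - dirD (ee i) (dirD (ee i) (dirD tt g)) p := fun i => by
    rw [Uti, dirD_sub _ (S _ (S _ sf)) (S _ (S _ sg))]
  -- equation for the difference
  have eU : ∀ t ∈ Set.Icc (0:ℝ) T, ∀ x, dirD tt (dirD tt U) (t, x)
      = ∑ i, (c ^ 2 * dirD (ee i) (dirD (ee i) U) (t, x)
        + b * dirD (ee i) (dirD (ee i) (dirD tt U)) (t, x)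
        - 2 * k * c ^ 2 * (dirD tt U (t, x) * dirD (ee i) (dirD (ee i) f) (t, x)
          + dirD tt g (t, x) * dirD (ee i) (dirD (ee i) U) (t, x))
        - 2 * σ * (dirD (ee i) U (t, x) * dirD (ee i) (dirD tt f) (t, x)
          + dirD (ee i) g (t, x) * dirD (ee i) (dirD tt U) (t, x))) := by
    intro t ht x
    have hA := ef t ht x
    have hB := eg t ht x
    have hA' : dirD tt (dirD tt f) (t, x) = ∑ i,
        (c ^ 2 * (1 - 2 * k * dirD tt f (t, x)) * dirD (ee i) (dirD (ee i) f) (t, x)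
        + b * dirD (ee i) (dirD (ee i) (dirD tt f)) (t, x)
        - 2 * σ * (dirD (ee i) f (t, x) * dirD (ee i) (dirD tt f) (t, x))) := by
      rw [Finset.sum_sub_distrib, Finset.sum_add_distrib, ← Finset.mul_sum, ← Finset.mul_sum,
        ← Finset.mul_sum]
      linarith
    have hB' : dirD tt (dirD tt g) (t, x) = ∑ i,
        (c ^ 2 * (1 - 2 * k * dirD tt g (t, x)) * dirD (ee i) (dirD (ee i) g) (t, x)
        + b * dirD (ee i) (dirD (ee i) (dirD tt g)) (t, x)
        - 2 * σ * (dirD (ee i) g (t, x) * dirD (ee i) (dirD tt g) (t, x))) := by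
      rw [Finset.sum_sub_distrib, Finset.sum_add_distrib, ← Finset.mul_sum, ← Finset.mul_sum,
        ← Finset.mul_sum]
      linarith
    rw [Utt]
    beta_reduce
    rw [hA', hB', ← Finset.sum_sub_distrib]
    refine Finset.sum_congr rfl fun i _ => ?_
    rw [Uii, Utii, Ut, Ui]
    rw [dirD_sub _ (S _ sf) (S _ sg)]
    ring
  -- energy density
  obtain ⟨F, hF⟩ : ∃ F : ℝ × Spc d → ℝ, F = fun p => dirD tt U p * dirD tt U p
      + ∑ i, c ^ 2 * (dirD (ee i) U p * dirD (ee i) U p) := ⟨_, rfl⟩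
  have nF : Nice K F := by
    refine ⟨?_, fun p hp => ?_⟩
    · rw [hF]
      exact ((S _ sU).mul (S _ sU)).add (ContDiff.sum fun i _ =>
        contDiff_const.mul ((S _ sU).mul (S _ sU)))
    · simp [hF, (N tt nU).2 p hp, fun i => (N (ee i) nU).2 p hp]
  have dF : ∀ p, dirD tt F p = 2 * dirD tt U p * dirD tt (dirD tt U) p
      + ∑ i, 2 * c ^ 2 * (dirD (ee i) U p * dirD (ee i) (dirD tt U) p) := by
    intro p
    have s1 : ∀ i : Fin d, ContDiff ℝ ∞ (fun p => c ^ 2 * (dirD (ee i) U p * dirD (ee i) U p)) :=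
      fun i => contDiff_const.mul ((S _ sU).mul (S _ sU))
    rw [hF, dirD_add _ _ ((S _ sU).mul (S _ sU)) (ContDiff.sum fun i _ => s1 i),
      dirD_mul _ _ (S _ sU) (S _ sU), dirD_sum _ _ s1]
    congr 1
    · ring
    · refine Finset.sum_congr rfl fun i _ => ?_
      rw [dirD_const_mul _ _ _ ((S _ sU).mul (S _ sU)), dirD_mul _ _ (S _ sU) (S _ sU),
        dirD_comm sU tt (ee i)]
      ring
  -- flux
  obtain ⟨H, hH⟩ : ∃ H : Fin d → ℝ × Spc d → ℝ, H = fun i p => dirD tt U p *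
      (2 * c ^ 2 * dirD (ee i) U p + (2 * b * dirD (ee i) (dirD tt U) p
        + (-4 * k * c ^ 2) * (dirD tt g p * dirD (ee i) U p))) := ⟨_, rfl⟩
  have sm1 : ∀ i : Fin d, ContDiff ℝ ∞ (fun p => 2 * c ^ 2 * dirD (ee i) U p) := fun i =>
    contDiff_const.mul (S _ sU)
  have sm2 : ∀ i : Fin d, ContDiff ℝ ∞ (fun p => 2 * b * dirD (ee i) (dirD tt U) p) := fun i =>
    contDiff_const.mul (S _ (S _ sU))
  have sm3 : ∀ i : Fin d, ContDiff ℝ ∞ (fun p => (-4 * k * c ^ 2) *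
      (dirD tt g p * dirD (ee i) U p)) := fun i =>
    contDiff_const.mul ((S _ sg).mul (S _ sU))
  have nH : ∀ i, Nice K (H i) := by
    intro i
    refine ⟨?_, fun p hp => ?_⟩
    · rw [hH]
      exact (S _ sU).mul ((sm1 i).add ((sm2 i).add (sm3 i)))
    · simp [hH, (N tt nU).2 p hp]
  have dH : ∀ i p, dirD (ee i) (H i) p = dirD (ee i) (dirD tt U) p *
      (2 * c ^ 2 * dirD (ee i) U p + (2 * b * dirD (ee i) (dirD tt U) p
        + (-4 * k * c ^ 2) * (dirD tt g p * dirD (ee i) U p)))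
      + dirD tt U p * (2 * c ^ 2 * dirD (ee i) (dirD (ee i) U) p
        + (2 * b * dirD (ee i) (dirD (ee i) (dirD tt U)) p
        + (-4 * k * c ^ 2) * (dirD (ee i) (dirD tt g) p * dirD (ee i) U p
          + dirD tt g p * dirD (ee i) (dirD (ee i) U) p))) := by
    intro i p
    rw [hH]
    beta_reduce
    rw [dirD_mul _ _ (S _ sU) ((sm1 i).add ((sm2 i).add (sm3 i))),
      dirD_add _ _ (sm1 i) ((sm2 i).add (sm3 i)), dirD_add _ _ (sm2 i) (sm3 i),
      dirD_const_mul _ _ _ (S _ sU), dirD_const_mul _ _ _ (S _ (S _ sU)),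
      dirD_const_mul _ _ _ ((S _ sg).mul (S _ sU)), dirD_mul _ _ (S _ sg) (S _ sU)]
  -- bound for the coefficients
  obtain ⟨R, hR⟩ : ∃ R : Fin d → ℝ × Spc d → ℝ, R = fun i p =>
      |2 * k * c ^ 2 * dirD (ee i) (dirD (ee i) f) p|
      + (((2 * k * c ^ 2 * dirD tt g p) ^ 2 + (-(2 * σ) * dirD (ee i) g p) ^ 2) / (2 * b)
      + |2 * k * c ^ 2 * dirD (ee i) (dirD tt g) p - 2 * σ * dirD (ee i) (dirD tt f) p|) :=
    ⟨_, rfl⟩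
  have cR : Continuous (fun p => ∑ i, R i p) := by
    refine continuous_finsetSum _ fun i _ => ?_
    rw [hR]
    have c1 := (S (ee i) (S (ee i) sf)).continuous
    have c2 := (S tt sg).continuous
    have c3 := (S (ee i) sg).continuous
    have c4 := (S (ee i) (S tt sg)).continuous
    have c5 := (S (ee i) (S tt sf)).continuous
    fun_prop
  have R0 : ∀ i p, 0 ≤ R i p := by
    intro i p
    rw [hR]
    positivity
  obtain ⟨M, hM⟩ := ((isCompact_Icc (a := (0:ℝ)) (b := T)).prod hK).exists_bound_of_continuousOn
    cR.continuousOn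
  -- pointwise bound
  have pw : ∀ t ∈ Set.Icc (0:ℝ) T, ∀ x, dirD tt F (t, x) - ∑ i, dirD (ee i) (H i) (t, x)
      ≤ 2 * (|M| * (1 + (c ^ 2)⁻¹)) * F (t, x) := by
    intro t ht x
    have F0 : ∀ p, 0 ≤ F p := fun p => by
      rw [hF]
      exact add_nonneg (mul_self_nonneg _) (Finset.sum_nonneg fun i _ =>
        mul_nonneg (sq_nonneg _) (mul_self_nonneg _))
    have Fle : ∀ i p, dirD tt U p ^ 2 + dirD (ee i) U p ^ 2 ≤ (1 + (c ^ 2)⁻¹) * F p := by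
      intro i p
      have h2 : dirD tt U p ^ 2 + c ^ 2 * dirD (ee i) U p ^ 2 ≤ F p := by
        rw [hF]
        have := Finset.single_le_sum (f := fun i => c ^ 2 * (dirD (ee i) U p * dirD (ee i) U p))
          (fun i _ => mul_nonneg (sq_nonneg _) (mul_self_nonneg _)) (Finset.mem_univ i)
        simp only at this ⊢
        nlinarith
      have hc2 : 0 < c ^ 2 := by positivity
      have h3 : dirD (ee i) U p ^ 2 = (c ^ 2)⁻¹ * (c ^ 2 * dirD (ee i) U p ^ 2) := by
        field_simp
      have h4 : (c ^ 2)⁻¹ * (c ^ 2 * dirD (ee i) U p ^ 2) ≤ (c ^ 2)⁻¹ * F p := by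
        apply mul_le_mul_of_nonneg_left _ (by positivity)
        nlinarith [sq_nonneg (dirD tt U p)]
      have h5 : 0 ≤ c ^ 2 * dirD (ee i) U p ^ 2 := by positivity
      nlinarith
    have step1 : dirD tt F (t, x) - ∑ i, dirD (ee i) (H i) (t, x)
        ≤ ∑ i, 2 * (R i (t, x) * ((1 + (c ^ 2)⁻¹) * F (t, x))) := by
      rw [dF, eU t ht x, Finset.mul_sum, ← Finset.sum_add_distrib, ← Finset.sum_sub_distrib]
      refine Finset.sum_le_sum fun i _ => ?_
      rw [dH]
      have qb := quad_bound (b := b) (A := 2 * k * c ^ 2 * dirD tt g (t, x))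
        (B := -(2 * σ) * dirD (ee i) g (t, x))
        (D := 2 * k * c ^ 2 * dirD (ee i) (dirD tt g) (t, x)
          - 2 * σ * dirD (ee i) (dirD tt f) (t, x))
        (a := dirD tt U (t, x)) (p := dirD (ee i) U (t, x))
        (q := dirD (ee i) (dirD tt U) (t, x)) hb
      have hl : -(2 * k * c ^ 2 * dirD (ee i) (dirD (ee i) f) (t, x)) * dirD tt U (t, x) ^ 2
          ≤ |2 * k * c ^ 2 * dirD (ee i) (dirD (ee i) f) (t, x)|
            * (dirD tt U (t, x) ^ 2 + dirD (ee i) U (t, x) ^ 2) := by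
        have e1 := neg_le_abs (2 * k * c ^ 2 * dirD (ee i) (dirD (ee i) f) (t, x))
        have e2 := mul_le_mul_of_nonneg_right e1 (sq_nonneg (dirD tt U (t, x)))
        have e3 : 0 ≤ |2 * k * c ^ 2 * dirD (ee i) (dirD (ee i) f) (t, x)|
          * dirD (ee i) U (t, x) ^ 2 := by positivity
        linarith
      have hr : R i (t, x) * (dirD tt U (t, x) ^ 2 + dirD (ee i) U (t, x) ^ 2)
          ≤ R i (t, x) * ((1 + (c ^ 2)⁻¹) * F (t, x)) :=
        mul_le_mul_of_nonneg_left (Fle i _) (R0 i _)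
      have hRe : R i (t, x) * (dirD tt U (t, x) ^ 2 + dirD (ee i) U (t, x) ^ 2)
        = |2 * k * c ^ 2 * dirD (ee i) (dirD (ee i) f) (t, x)|
            * (dirD tt U (t, x) ^ 2 + dirD (ee i) U (t, x) ^ 2)
          + (((2 * k * c ^ 2 * dirD tt g (t, x)) ^ 2
            + (-(2 * σ) * dirD (ee i) g (t, x)) ^ 2) / (2 * b)
      + |2 * k * c ^ 2 * dirD (ee i) (dirD tt g) (t, x)
          - 2 * σ * dirD (ee i) (dirD tt f) (t, x)|)
            * (dirD tt U (t, x) ^ 2 + dirD (ee i) U (t, x) ^ 2) := by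
        rw [hR]; ring
      linarith
    refine step1.trans ?_
    rw [← Finset.mul_sum, ← Finset.sum_mul]
    by_cases hx : x ∈ K
    · have hm := (le_abs_self _).trans ((hM (t, x) ⟨ht, hx⟩).trans (le_abs_self M))
      have h6 : 0 ≤ (1 + (c ^ 2)⁻¹) * F (t, x) := mul_nonneg (by positivity) (F0 _)
      have := mul_le_mul_of_nonneg_right hm h6
      linarith
    · simp [nF.2 (t, x) hx]
  have hE := gronwall_zero (E := fun t => ∫ x, F (t, x)) (E' := fun t => ∫ x, dirD tt F (t, x))
    (C := 2 * (|M| * (1 + (c ^ 2)⁻¹))) (T := T) ?_ ?_ (fun t => int_hasDeriv hK nF t) ?_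
  · intro t ht x
    have hz := hE t ht
    beta_reduce at hz
    have Fn : (0 : Spc d → ℝ) ≤ fun x => F (t, x) := by
      intro x
      simp only [hF]
      exact add_nonneg (mul_self_nonneg _) (Finset.sum_nonneg fun i _ =>
        mul_nonneg (sq_nonneg _) (mul_self_nonneg _))
    rw [integral_eq_zero_iff_of_nonneg Fn (nice_int hK nF t)] at hz
    have cF : Continuous fun x => F (t, x) := nF.1.continuous.comp (by fun_prop)
    have hz2 := (Continuous.ae_eq_iff_eq volume cF continuous_zero).1 hz
    have hzx := congrFun hz2 x
    simp only [hF, Pi.zero_apply] at hzx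
    have hs : 0 ≤ ∑ i, c ^ 2 * (dirD (ee i) U (t, x) * dirD (ee i) U (t, x)) :=
      Finset.sum_nonneg fun i _ => mul_nonneg (sq_nonneg _) (mul_self_nonneg _)
    have := mul_self_nonneg (dirD tt U (t, x))
    exact mul_self_eq_zero.mp (by linarith)
  · have : ∀ x, F (0, x) = 0 := by
      intro x
      have z1 : dirD tt U (0, x) = 0 := by rw [Ut]; simp [h1]
      have z2 : ∀ i, dirD (ee i) U (0, x) = 0 := by
        intro i
        have := slice_x sU 0 x (EuclideanSpace.single i 1)
        change _ = dirD (ee i) U (0, x) at this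
        rw [← this]
        simp [hU, h0]
      simp [hF, z1, z2]
    simp [this]
  · intro t
    refine integral_nonneg fun x => ?_
    simp only [hF]
    exact add_nonneg (mul_self_nonneg _) (Finset.sum_nonneg fun i _ =>
        mul_nonneg (sq_nonneg _) (mul_self_nonneg _))
  · intro t ht
    have hi := fun i => nice_int hK (N (ee i) (nH i)) t
    have hi0 : ∀ i, ∫ x, dirD (ee i) (H i) (t, x) = 0 := fun i => int_dirD_zero hK (nH i) t _
    have e : ∫ x, dirD tt F (t, x) = ∫ x, (dirD tt F (t, x) - ∑ i, dirD (ee i) (H i) (t, x)) := by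
      rw [integral_sub (nice_int hK (N tt nF) t) (integrable_finsetSum _ fun i _ => hi i),
        integral_finsetSum _ fun i _ => hi i]
      simp [hi0]
    beta_reduce
    rw [e, ← integral_const_mul]
    exact integral_mono ((nice_int hK (N tt nF) t).sub (integrable_finsetSum _ fun i _ => hi i))
      ((nice_int hK nF t).const_mul _) (pw t ht)

/-- uniqueness of small solutions of the Blackstock equation
in the time-weighted solution space. -/
theorem blackstock_uniqueness (d : ℕ) (hd : d = 1 ∨ d = 2 ∨ d = 3)
    (Ω : Set (Spc d)) (hne : Ω.Nonempty) (hop : IsOpen Ω) (hbd : Bornology.IsBounded Ω)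
    (b c k σ : ℝ) (hb : 0 < b) (hc : 0 < c) (T : ℝ) (hT : 0 < T) :
    ∃ δ > (0:ℝ),
      ∀ ψ φ : ℝ → Spc d → ℝ, Admissible Ω ψ → Admissible Ω φ →
        (∀ t ∈ Set.Icc (0:ℝ) T, IsBlackstock Ω b c k σ ψ t) →
        (∀ t ∈ Set.Icc (0:ℝ) T, IsBlackstock Ω b c k σ φ t) →
        (∀ x, ψ 0 x = φ 0 x) → (∀ x, tderiv ψ 0 x = tderiv φ 0 x) →
        normX Ω T ψ ≤ δ → normX Ω T φ ≤ δ →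
        ∀ t ∈ Set.Icc (0:ℝ) T, ∀ x ∈ Ω, ψ t x = φ t x := by
  refine ⟨1, one_pos, ?_⟩
  intro ψ φ hψ hφ eψ eφ h0 h1 _ _
  obtain ⟨sψ, K1, hK1, hK1Ω, hs1⟩ := hψ
  obtain ⟨sφ, K2, hK2, hK2Ω, hs2⟩ := hφ
  have hK : IsCompact (K1 ∪ K2) := hK1.union hK2
  have hKΩ : K1 ∪ K2 ⊆ Ω := Set.union_subset hK1Ω hK2Ω
  have n1 : Nice (K1 ∪ K2) (fun p : ℝ × Spc d => ψ p.1 p.2) := by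
    refine ⟨sψ, fun p hp => ?_⟩
    by_contra hne
    exact hp (Or.inl (hs1 p.1 hne))
  have n2 : Nice (K1 ∪ K2) (fun p : ℝ × Spc d => φ p.1 p.2) := by
    refine ⟨sφ, fun p hp => ?_⟩
    by_contra hne
    exact hp (Or.inr (hs2 p.1 hne))
  have key := diff_tderiv_zero hK hb hc n1 n2
    (fun t ht x => blackstock_eq hK hKΩ n1 (eψ t ht) x)
    (fun t ht x => blackstock_eq hK hKΩ n2 (eφ t ht) x) h0
    (fun x => by
      have e1 := congrFun (congrFun (tderiv_eq n1.1) 0) x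
      have e2 := congrFun (congrFun (tderiv_eq n2.1) 0) x
      exact e1.symm.trans ((h1 x).trans e2))
  intro t ht x _
  have hd := fun s => slice_t (n1.1.sub n2.1) s x
  have hconst := constant_of_has_deriv_right_zero (f := fun s => ψ s x - φ s x) (a := 0) (b := T)
    (fun s _ => (hd s).continuousAt.continuousWithinAt)
    (fun s hs => by
      have h2 := (hd s).hasDerivWithinAt (s := Set.Ici s)
      have h3 := key s ⟨hs.1, hs.2.le⟩ x
      change dirD (1, 0) (fun p : ℝ × Spc d => ψ p.1 p.2 - φ p.1 p.2) (s, x) = 0 at h3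
      rw [← h3]
      exact h2) t ht
  simp only [h0 x, sub_self] at hconst
  linarith
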